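/- Let n, u, v ∈ ℝ³ with |n| = 1, u·n = 0 and v·n = 0. If 2(u⊗u + v⊗v) = (|u|² + |v|²)(I − n⊗n), then |u| = |v| and u·v = 0. -/

import Mathlib

open Matrix

/-- If `n` is a unit vector, `u, v ⟂ n`, and `2(u⊗u + v⊗v) = (|u|² + |v|²)(I - n⊗n)`,
then `|u| = |v|` and `u · v = 0`. -/
theorem projection_implies_conformal_relations
    (n u v : Fin 3 → ℝ)
    (hn : n ⬝ᵥ n = 1)
    (hun : u ⬝ᵥ n = 0) (hvn : v ⬝ᵥ n = 0)
    (h : (2 : ℝ) • (vecMulVec u u + vecMulVec v v)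
      = (u ⬝ᵥ u + v ⬝ᵥ v) • ((1 : Matrix (Fin 3) (Fin 3) ℝ) - vecMulVec n n)) :
    u ⬝ᵥ u = v ⬝ᵥ v ∧ u ⬝ᵥ v = 0 := by
  have h1 := congrArg (fun M => u ⬝ᵥ (M *ᵥ u)) h
  have h2 := congrArg (fun M => v ⬝ᵥ (M *ᵥ v)) h
  have hnu : n ⬝ᵥ u = 0 := by rw [dotProduct_comm, hun]
  have hnv : n ⬝ᵥ v = 0 := by rw [dotProduct_comm, hvn]
  simp [smul_mulVec, add_mulVec, sub_mulVec, vecMulVec_mulVec, hnu, hnv,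
    dotProduct_comm v u] at h1 h2
  generalize u ⬝ᵥ u = a at *
  generalize v ⬝ᵥ v = b at *
  generalize u ⬝ᵥ v = c at *
  have h3 : (a - b) ^ 2 + 4 * c ^ 2 = 0 := by linarith
  constructor
  · have : (a - b) ^ 2 = 0 := by nlinarith [sq_nonneg (a - b), sq_nonneg c]
    exact sub_eq_zero.mp (pow_eq_zero_iff two_ne_zero |>.mp this)
  · have : c ^ 2 = 0 := by nlinarith [sq_nonneg (a - b), sq_nonneg c]
    exact pow_eq_zero_iff two_ne_zero |>.mp this
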